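/- The double integral ∫₀^∞ ∫₀^∞ J₁(x)² J₁(y)² / (xy) · log(x²+y²) dx dy equals (4 + 8G + π - 4γπ + 4π log 2)/(8π), where J₁ is the Bessel function of the first kind of order 1, G is Catalan's constant, and γ is the Euler–Mascheroni constant. -/

import Mathlib

open MeasureTheory

/-- The Bessel function of the first kind of integer order `n`, via its power series. -/
noncomputable def besselJ (n : ℕ) (x : ℝ) : ℝ :=
  ∑' m : ℕ, (-1)^m / ((m.factorial : ℝ) * ((m+n).factorial : ℝ)) * (x/2)^(2*m+n)

/-- Catalan's constant. -/
noncomputable def catalanConst : ℝ := ∑' n : ℕ, (-1)^n / (2*(n:ℝ)+1)^2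

open Set Filter Topology

namespace BLI

lemma int_log_exp : ∫ t in Ioi (0:ℝ), Real.log t * Real.exp (-t) = -Real.eulerMascheroniConstant := by
  have h1 := Complex.hasDerivAt_GammaIntegral (s := 1) (by simp)
  have h2 : HasDerivAt Complex.GammaIntegral (-(Real.eulerMascheroniConstant:ℂ)) 1 := by
    refine Complex.hasDerivAt_Gamma_one.congr_of_eventuallyEq ?_
    have : {z : ℂ | 0 < z.re} ∈ 𝓝 (1:ℂ) :=
      (isOpen_lt continuous_const Complex.continuous_re).mem_nhds (by simp)
    filter_upwards [this] with z hz
    exact (Complex.Gamma_eq_integral hz).symm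
  have h3 := h1.unique h2
  have h4 : (∫ t in Ioi (0:ℝ), ((t:ℂ) ^ ((1:ℂ) - 1) * (Real.log t * Real.exp (-t)))) =
      ((∫ t in Ioi (0:ℝ), Real.log t * Real.exp (-t) : ℝ) : ℂ) := by
    rw [← integral_complex_ofReal]
    refine setIntegral_congr_fun measurableSet_Ioi fun t _ => ?_
    simp
  rw [h4] at h3
  exact_mod_cast h3

lemma integrable_log_exp : IntegrableOn (fun t => Real.log t * Real.exp (-t)) (Ioi (0:ℝ)) := by
  refine Integrable.of_integral_ne_zero ?_
  rw [int_log_exp]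
  have := Real.one_half_lt_eulerMascheroniConstant
  intro h; linarith

lemma log_exp_scaled (r : ℝ) (hr : 0 < r) :
    IntegrableOn (fun s => r * Real.exp (-(r*s)) * Real.log s) (Ioi (0:ℝ)) ∧
    ∫ s in Ioi (0:ℝ), r * Real.exp (-(r*s)) * Real.log s = - Real.eulerMascheroniConstant - Real.log r := by
  have hE : IntegrableOn (fun t => Real.exp (-t)) (Ioi (0:ℝ)) := by
    simpa using (exp_neg_integrableOn_Ioi 0 (b := 1) one_pos)
  have hI : IntegrableOn (fun t => Real.log t * Real.exp (-t) - Real.log r * Real.exp (-t)) (Ioi (0:ℝ)) :=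
    integrable_log_exp.sub (hE.const_mul _)
  have hc : ∀ s ∈ Ioi (0:ℝ), r * Real.exp (-(r*s)) * Real.log s =
      r * (fun t => Real.log t * Real.exp (-t) - Real.log r * Real.exp (-t)) (r * s) := by
    intro s hs
    simp only
    rw [Real.log_mul hr.ne' (ne_of_gt hs)]; ring
  constructor
  · rw [integrableOn_congr_fun hc measurableSet_Ioi]
    refine Integrable.const_mul ?_ r
    exact (integrableOn_Ioi_comp_mul_left_iff _ 0 hr).2 (by simpa using hI)
  · rw [setIntegral_congr_fun measurableSet_Ioi hc, integral_const_mul,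
      integral_comp_mul_left_Ioi
        (fun t => Real.log t * Real.exp (-t) - Real.log r * Real.exp (-t)) 0 hr, mul_zero, integral_sub integrable_log_exp (hE.const_mul _),
      int_log_exp, integral_const_mul, integral_exp_neg_Ioi_zero]
    simp [hr.ne']

/-- The Frullani type kernel. -/
noncomputable def ker (r s : ℝ) : ℝ := ((if s ≤ 1 then 1 else 0) - Real.exp (-(r*s)))/s

lemma ker_integral (r : ℝ) (hr : 0 < r) :
    IntegrableOn (ker r) (Ioi (0:ℝ)) ∧
    ∫ s in Ioi (0:ℝ), ker r s = Real.eulerMascheroniConstant + Real.log r := by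
  obtain ⟨hL, hLi⟩ := log_exp_scaled r hr
  have hU : Ioi (0:ℝ) = Ioc 0 1 ∪ Ioi 1 := (Ioc_union_Ioi_eq_Ioi zero_le_one).symm
  have hL0 : IntegrableOn (fun s => r * Real.exp (-(r*s)) * Real.log s) (Ioc (0:ℝ) 1) :=
    hL.mono_set Ioc_subset_Ioi_self
  have hL1 : IntegrableOn (fun s => r * Real.exp (-(r*s)) * Real.log s) (Ioi (1:ℝ)) :=
    hL.mono_set (Ioi_subset_Ioi zero_le_one)
  have e0 : ∀ s ∈ Ioc (0:ℝ) 1, ker r s = (1 - Real.exp (-(r*s)))/s := by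
    intro s hs; simp [ker, hs.2]
  have e1 : ∀ s ∈ Ioi (1:ℝ), ker r s = - (Real.exp (-(r*s))/s) := by
    intro s hs; simp [ker, not_le.2 (mem_Ioi.1 hs), neg_div]
  have k0 : IntegrableOn (fun s => (1 - Real.exp (-(r*s)))/s) (Ioc (0:ℝ) 1) := by
    refine Measure.integrableOn_of_bounded (M := r) (by simp) (Measurable.aestronglyMeasurable (by fun_prop)) ?_
    refine (ae_restrict_iff' measurableSet_Ioc).2 (ae_of_all _ fun s hs => ?_)
    have h1 := Real.add_one_le_exp (-(r*s))
    have h2 : Real.exp (-(r*s)) ≤ 1 := Real.exp_le_one_iff.2 (by nlinarith [hs.1])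
    rw [Real.norm_eq_abs, abs_of_nonneg (div_nonneg (by linarith) hs.1.le), div_le_iff₀ hs.1]
    linarith
  have k1 : IntegrableOn (fun s => -(Real.exp (-(r*s))/s)) (Ioi (1:ℝ)) := by
    refine Integrable.neg ?_
    refine Integrable.mono' (exp_neg_integrableOn_Ioi 1 hr) (Measurable.aestronglyMeasurable (by fun_prop)) ?_
    refine (ae_restrict_iff' measurableSet_Ioi).2 (ae_of_all _ fun s hs => ?_)
    have hs' : (1:ℝ) < s := hs
    rw [Real.norm_eq_abs, abs_of_nonneg (by positivity), neg_mul]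
    exact div_le_self (Real.exp_pos _).le hs'.le
  have kk0 : IntegrableOn (ker r) (Ioc (0:ℝ) 1) := (integrableOn_congr_fun e0 measurableSet_Ioc).2 k0
  have kk1 : IntegrableOn (ker r) (Ioi (1:ℝ)) := (integrableOn_congr_fun e1 measurableSet_Ioi).2 k1
  refine ⟨hU ▸ kk0.union kk1, ?_⟩
  have F1 : ∫ s in Ioi (1:ℝ), (r * Real.exp (-(r*s)) * Real.log s + -(Real.exp (-(r*s))/s)) = 0 - 0 := by
    have := integral_Ioi_of_hasDerivAt_of_tendsto' (a := (1:ℝ)) (m := (0:ℝ))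
      (f := fun s => -Real.exp (-(r*s)) * Real.log s)
      (f' := fun s => r * Real.exp (-(r*s)) * Real.log s + -(Real.exp (-(r*s))/s)) ?_ (hL1.add k1) ?_
    · simpa using this
    · intro s hs
      have hs' : (1:ℝ) ≤ s := hs
      have h := (((hasDerivAt_id s).const_mul r).neg.exp.neg).mul (Real.hasDerivAt_log (x := s) (by linarith))
      refine h.congr_deriv ?_
      simp; ring
    · have h := (Real.isLittleO_log_id_atTop).isBigO
      have h2 : Tendsto (fun s : ℝ => s * Real.exp (-(r*s))) atTop (𝓝 0) := by
        have := Real.tendsto_pow_mul_exp_neg_atTop_nhds_zero 1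
        have h3 := (this.comp (tendsto_id.const_mul_atTop hr)).const_mul (r⁻¹)
        refine (h3.congr ?_).trans (by simp)
        intro s; simp; field_simp
      have h3 : Tendsto (fun s : ℝ => Real.exp (-(r*s)) * Real.log s) atTop (𝓝 0) := by
        refine squeeze_zero_norm' ?_ h2
        filter_upwards [eventually_ge_atTop 1] with s hs
        rw [Real.norm_eq_abs, abs_of_nonneg (mul_nonneg (Real.exp_pos _).le (Real.log_nonneg hs)), mul_comm]
        exact mul_le_mul_of_nonneg_right (Real.log_le_self (by linarith)) (Real.exp_pos _).le
      simpa using h3.neg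
  have F0 : ∫ s in Ioc (0:ℝ) 1, (r * Real.exp (-(r*s)) * Real.log s + (1 - Real.exp (-(r*s)))/s) = 0 := by
    rw [← intervalIntegral.integral_of_le zero_le_one]
    have := intervalIntegral.integral_eq_sub_of_hasDerivAt_of_le (a := (0:ℝ)) (b := 1) zero_le_one
      (f := fun s => (1 - Real.exp (-(r*s))) * Real.log s)
      (f' := fun s => r * Real.exp (-(r*s)) * Real.log s + (1 - Real.exp (-(r*s)))/s) ?_ ?_ ?_
    · simpa using this
    · intro s hs
      rcases eq_or_lt_of_le hs.1 with h0 | h0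
      · subst h0
        have hb : Tendsto (fun s : ℝ => r * (s * Real.log s)) (𝓝 0) (𝓝 0) := by
          have := (Real.continuous_mul_log.tendsto 0).const_mul r
          simpa using this
        have : Tendsto (fun s => (1 - Real.exp (-(r*s))) * Real.log s) (𝓝[Icc 0 1] 0) (𝓝 0) := by
          refine squeeze_zero_norm' ?_ ((hb.mono_left nhdsWithin_le_nhds).norm.trans (by simp))
          filter_upwards [self_mem_nhdsWithin] with s hs
          have h1 := Real.add_one_le_exp (-(r*s))
          have h2 : Real.exp (-(r*s)) ≤ 1 := Real.exp_le_one_iff.2 (by nlinarith [hs.1])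
          rw [norm_mul, norm_mul, norm_mul, ← mul_assoc]
          refine mul_le_mul_of_nonneg_right ?_ (norm_nonneg _)
          rw [← norm_mul, Real.norm_eq_abs, Real.norm_eq_abs, abs_of_nonneg (by linarith),
            abs_of_nonneg (mul_nonneg hr.le hs.1)]
          linarith
        simpa [ContinuousWithinAt] using this
      · exact ContinuousAt.continuousWithinAt (by fun_prop (disch := exact h0.ne'))
    · intro s hs
      have h := (((hasDerivAt_id s).const_mul r).neg.exp.const_sub 1).mul (Real.hasDerivAt_log (x := s) (ne_of_gt hs.1))
      refine h.congr_deriv ?_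
      simp; ring
    · exact (intervalIntegrable_iff_integrableOn_Ioc_of_le zero_le_one).2 (hL0.add k0)
  rw [integral_add hL1 k1] at F1
  rw [integral_add hL0 k0] at F0
  rw [hU, setIntegral_union (Ioc_disjoint_Ioi_same) measurableSet_Ioi hL0 hL1] at hLi
  rw [hU, setIntegral_union (Ioc_disjoint_Ioi_same) measurableSet_Ioi kk0 kk1,
    setIntegral_congr_fun measurableSet_Ioc e0, setIntegral_congr_fun measurableSet_Ioi e1]
  linarith


/-- coefficients of `J₁(x)²` -/
noncomputable def bc (n : ℕ) : ℝ :=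
  (-1)^n * ((2*n+2).choose n : ℝ) / ((n+1).factorial : ℝ)^2 / 4^(n+1)

lemma summable_J (x : ℝ) : Summable (fun m : ℕ => ‖(-1:ℝ)^m / ((m.factorial : ℝ) * ((m+1).factorial : ℝ)) * (x/2)^(2*m+1)‖) := by
  have h := (Real.summable_pow_div_factorial ((x/2)^2)).mul_right (|x/2|)
  refine Summable.of_nonneg_of_le (fun _ => norm_nonneg _) (fun m => ?_) h
  rw [norm_mul, norm_div, norm_pow, norm_neg, norm_one, one_pow, pow_succ, pow_mul, norm_mul (_ ^ m),
    ← mul_assoc, Real.norm_eq_abs (x/2)]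
  refine mul_le_mul_of_nonneg_right ?_ (abs_nonneg _)
  have h1 : (1:ℝ) ≤ (m+1).factorial := by exact_mod_cast Nat.succ_le_of_lt (Nat.factorial_pos _)
  have h0 : (0:ℝ) < m.factorial := by exact_mod_cast (Nat.factorial_pos _)
  rw [Real.norm_eq_abs, Real.norm_eq_abs, abs_of_nonneg (by positivity), abs_of_nonneg (by positivity),
    div_mul_eq_mul_div, one_mul]
  gcongr
  nlinarith

lemma bc_antidiag (x : ℝ) (n : ℕ) :
    ∑ kl ∈ Finset.HasAntidiagonal.antidiagonal n,
      ((-1:ℝ)^kl.1 / ((kl.1.factorial : ℝ) * ((kl.1+1).factorial : ℝ)) * (x/2)^(2*kl.1+1)) *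
      ((-1:ℝ)^kl.2 / ((kl.2.factorial : ℝ) * ((kl.2+1).factorial : ℝ)) * (x/2)^(2*kl.2+1))
      = bc n * x^(2*n+2) := by
  have hV := Nat.add_choose_eq (n+1) (n+1) n
  have hV' : (((2*n+2).choose n : ℕ) : ℝ) =
      ∑ ij ∈ Finset.HasAntidiagonal.antidiagonal n, ((n+1).choose ij.1 : ℝ) * ((n+1).choose ij.2 : ℝ) := by
    rw [show 2*n+2 = n+1+(n+1) by ring, hV]; push_cast; rfl
  rw [bc, hV', Finset.mul_sum, Finset.sum_div, Finset.sum_div, Finset.sum_mul]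
  refine Finset.sum_congr rfl fun ij hij => ?_
  obtain ⟨i, j⟩ := ij
  have hij' : i + j = n := by simpa using hij
  subst hij'
  have hi : ((i+j+1).choose i : ℝ) = ((i+j+1).factorial : ℝ) / (i.factorial * (j+1).factorial) := by
    rw [Nat.cast_choose ℝ (by omega), show i+j+1-i = j+1 by omega]
  have hj : ((i+j+1).choose j : ℝ) = ((i+j+1).factorial : ℝ) / (j.factorial * (i+1).factorial) := by
    rw [Nat.cast_choose ℝ (by omega), show i+j+1-j = i+1 by omega]
  simp only [hi, hj]
  have h0 : ∀ k : ℕ, (k.factorial : ℝ) ≠ 0 := fun k => by exact_mod_cast (Nat.factorial_ne_zero _)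
  have h4 : (4:ℝ)^(i+j+1) = 2^(2*i+1) * 2^(2*j+1) := by
    rw [← pow_add, show (4:ℝ) = 2^2 by norm_num, ← pow_mul]; congr 1; ring
  have := h0 (i+j+1); have := h0 i; have := h0 j; have := h0 (i+1); have := h0 (j+1)
  rw [h4, div_pow, div_pow, show 2*(i+j)+2 = (2*i+1)+(2*j+1) by ring, pow_add x, pow_add (-1:ℝ)]
  field_simp
  ring

lemma hasSum_Jsq (x : ℝ) : HasSum (fun n => bc n * x^(2*n+2)) (besselJ 1 x ^ 2) := by
  have hs := summable_J x
  have h1 := tsum_mul_tsum_eq_tsum_sum_antidiagonal_of_summable_norm hs hs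
  have h2 := (summable_norm_sum_mul_antidiagonal_of_summable_norm hs hs).of_norm
  simp only [bc_antidiag] at h1 h2
  have := h2.hasSum
  rw [← h1] at this
  convert! this using 1
  rw [besselJ, sq]

lemma gauss_moment (n : ℕ) (t : ℝ) (ht : 0 < t) :
    IntegrableOn (fun x : ℝ => x^(2*n+1) * Real.exp (-(t*x^2))) (Ioi 0) ∧
    ∫ x in Ioi (0:ℝ), x^(2*n+1) * Real.exp (-(t*x^2)) = n.factorial / (2 * t^(n+1)) := by
  have e : ∀ x ∈ Ioi (0:ℝ), x^(2*n+1) * Real.exp (-(t*x^2)) =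
      x^((2*n+1 : ℕ):ℝ) * Real.exp (-t * x^(2:ℝ)) := by
    intro x hx
    rw [Real.rpow_natCast, Real.rpow_two]; ring_nf
  have hv : ∫ x in Ioi (0:ℝ), x^(2*n+1) * Real.exp (-(t*x^2)) = n.factorial / (2 * t^(n+1)) := by
    rw [setIntegral_congr_fun measurableSet_Ioi e,
      integral_rpow_mul_exp_neg_mul_rpow (by norm_num) (lt_of_lt_of_le (by norm_num) (Nat.cast_nonneg _)) ht]
    have h1 : (((2*n+1 : ℕ):ℝ) + 1)/2 = (n:ℝ) + 1 := by push_cast; ring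
    have h2 : -((((2*n+1 : ℕ):ℝ) + 1))/2 = -((n+1 : ℕ):ℝ) := by push_cast; ring
    rw [h1, h2, Real.Gamma_nat_eq_factorial, Real.rpow_neg ht.le, Real.rpow_natCast]
    field_simp
  refine ⟨Integrable.of_integral_ne_zero ?_, hv⟩
  rw [hv]; positivity

lemma bc_abs_le (n : ℕ) (t : ℝ) (ht : 0 < t) :
    |bc n| * (n.factorial / (2 * t^(n+1))) ≤ (1/t)^(n+1) / (n+1).factorial := by
  have hC : (((2*n+2).choose n : ℕ) : ℝ) ≤ 4^(n+1) := by
    have := Nat.choose_le_two_pow (2*n+2) n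
    calc (((2*n+2).choose n : ℕ) : ℝ) ≤ ((2^(2*n+2) : ℕ) : ℝ) := by exact_mod_cast this
      _ = 4^(n+1) := by push_cast; rw [show (4:ℝ) = 2^2 by norm_num, ← pow_mul]; congr 1
  have hf : (n.factorial : ℝ) ≤ (n+1).factorial := by exact_mod_cast Nat.factorial_le (by omega)
  have h0 : (0:ℝ) < (n+1).factorial := by exact_mod_cast (Nat.factorial_pos _)
  have h00 : (0:ℝ) < n.factorial := by exact_mod_cast (Nat.factorial_pos _)
  rw [bc, abs_div, abs_div, abs_mul, abs_pow, abs_neg, abs_one, one_pow, one_mul, abs_of_nonneg (by positivity : (0:ℝ) ≤ (((2*n+2).choose n : ℕ) : ℝ)),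
   abs_of_nonneg (by positivity : (0:ℝ) ≤ (4:ℝ)^(n+1)), abs_of_nonneg (by positivity : (0:ℝ) ≤ ((n+1).factorial : ℝ)^2)]
  calc _ ≤ ((4:ℝ)^(n+1) / ((n+1).factorial : ℝ)^2 / 4^(n+1)) * ((n+1).factorial / (1 * t^(n+1))) := by
        gcongr; norm_num
    _ = _ := by rw [div_pow, one_pow]; field_simp

/-- the weight -/
noncomputable def wt (x : ℝ) : ℝ := besselJ 1 x ^ 2 / x

lemma wt_nonneg {x : ℝ} (hx : 0 < x) : 0 ≤ wt x := div_nonneg (sq_nonneg _) hx.le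

lemma wt_hasSum (t : ℝ) (ht : 0 < t) :
    HasSum (fun n => bc n * (n.factorial / (2 * t^(n+1)))) (∫ x in Ioi (0:ℝ), wt x * Real.exp (-(t*x^2))) := by
  let f : ℕ → ℝ → ℝ := fun n x => bc n * (x^(2*n+1) * Real.exp (-(t*x^2)))
  have hf : ∀ n, Integrable (f n) (volume.restrict (Ioi 0)) := fun n => (gauss_moment n t ht).1.const_mul _
  have hn : ∀ n, ∫ x in Ioi (0:ℝ), ‖f n x‖ = |bc n| * (n.factorial / (2 * t^(n+1))) := by
    intro n
    rw [← (gauss_moment n t ht).2, ← integral_const_mul]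
    refine setIntegral_congr_fun measurableSet_Ioi fun x hx => ?_
    have hx' : (0:ℝ) < x := hx
    simp only [f]
    rw [norm_mul, Real.norm_eq_abs, Real.norm_eq_abs, abs_of_nonneg (a := x^(2*n+1) * _) (by positivity)]
  have hS : Summable fun n => ∫ x in Ioi (0:ℝ), ‖f n x‖ := by
    simp only [hn]
    refine Summable.of_nonneg_of_le (fun n => by positivity) (fun n => bc_abs_le n t ht) ?_
    exact (summable_nat_add_iff 1).2 (Real.summable_pow_div_factorial (1/t))
  have hsum : ∀ x ∈ Ioi (0:ℝ), HasSum (fun n => f n x) (wt x * Real.exp (-(t*x^2))) := by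
    intro x hx
    have hx' : x ≠ 0 := ne_of_gt hx
    have := ((hasSum_Jsq x).mul_right (1/x)).mul_right (Real.exp (-(t*x^2)))
    convert! this using 1
    · funext n; simp only [f]
      rw [show 2*n+2 = 2*n+1+1 by ring, pow_succ x (2*n+1)]; field_simp
    · rw [wt]; field_simp
  have h := hasSum_integral_of_summable_integral_norm hf hS
  have e : ∀ x ∈ Ioi (0:ℝ), ∑' n, f n x = wt x * Real.exp (-(t*x^2)) := fun x hx => (hsum x hx).tsum_eq
  rw [setIntegral_congr_fun measurableSet_Ioi e] at h
  convert! h using 1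
  funext n
  simp only [f]
  rw [integral_const_mul, (gauss_moment n t ht).2]

open Real in
lemma sin_even (m : ℕ) : ∫ x in (0:ℝ)..π, sin x ^ (2*m) = π * (2*m).choose m / 4^m := by
  induction m with
  | zero => simp
  | succ m ih =>
    have h := integral_sin_pow (a := 0) (b := π) (2*m)
    rw [show 2*(m+1) = 2*m+2 by ring, h, ih]
    have hc := Nat.succ_mul_centralBinom_succ m
    rw [Nat.centralBinom, Nat.centralBinom] at hc
    have hc' : ((m:ℝ)+1) * ((2*(m+1)).choose (m+1) : ℕ) = 2 * (2*m+1) * ((2*m).choose m : ℕ) := by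
      exact_mod_cast hc
    have e : (((2*m+2).choose (m+1) : ℕ) : ℝ) = 2 * (2*m+1) * ((2*m).choose m : ℕ) / (m+1) := by
      rw [eq_div_iff (by positivity), ← hc']
      rw [show 2*(m+1) = 2*m+2 by ring]; ring
    rw [e]
    simp
    field_simp
    ring

open Real in
lemma sin_cos_even (n : ℕ) : ∫ x in (0:ℝ)..π, cos x ^ 2 * sin x ^ (2*(n+1)) =
    (π/2) * ((2*n+2).choose n : ℝ) * n.factorial / ((n+1).factorial * 4^(n+1)) := by
  have h : ∀ x : ℝ, cos x ^ 2 * sin x ^ (2*(n+1)) = sin x ^ (2*(n+1)) - sin x ^ (2*(n+2)) := by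
    intro x; rw [cos_sq']; ring
  simp only [h]
  rw [intervalIntegral.integral_sub (Continuous.intervalIntegrable (by fun_prop) _ _) (Continuous.intervalIntegrable (by fun_prop) _ _),
    sin_even, sin_even]
  have hc := Nat.succ_mul_centralBinom_succ (n+1)
  rw [Nat.centralBinom, Nat.centralBinom] at hc
  have hc' : ((n:ℝ)+2) * ((2*(n+2)).choose (n+2) : ℕ) = 2 * (2*(n+1)+1) * ((2*(n+1)).choose (n+1) : ℕ) := by
    have : (((n+1+1) * (2*(n+1+1)).choose (n+1+1) : ℕ):ℝ) = ((2 * (2*(n+1)+1) * (2*(n+1)).choose (n+1) : ℕ):ℝ) := by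
      exact_mod_cast hc
    push_cast at this
    linear_combination this
  have e : (((2*(n+2)).choose (n+2) : ℕ) : ℝ) = 2 * (2*(n+1)+1) * ((2*(n+1)).choose (n+1) : ℕ) / (n+2) := by
    rw [eq_div_iff (by positivity), ← hc']; ring
  have e2 : ((2*(n+1)).choose (n+1) : ℝ) = (2*n+2).choose n * (n+2) / (n+1) := by
    have := Nat.choose_succ_right_eq (2*n+2) n
    rw [show 2*n+2-n = n+2 by omega] at this
    rw [eq_div_iff (by positivity)]
    exact_mod_cast this
  rw [e, e2, Nat.factorial_succ]
  have := Nat.factorial_pos n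
  push_cast
  field_simp
  ring

/-- The Laplace transform `g`. -/
noncomputable def gI (s : ℝ) : ℝ :=
  (2/Real.pi) * ∫ x in (0:ℝ)..Real.pi, Real.cos x ^ 2 * Real.exp (-(Real.sin x ^ 2 * s))

open Real in
lemma one_sub_gI (s : ℝ) : 1 - gI s = (2/π) * ∫ x in (0:ℝ)..π, cos x ^ 2 * (1 - exp (-(sin x ^ 2 * s))) := by
  have : ∫ x in (0:ℝ)..π, cos x ^ 2 = π/2 := by rw [integral_cos_sq]; simp
  simp only [mul_sub, mul_one]
  rw [intervalIntegral.integral_sub (Continuous.intervalIntegrable (by fun_prop) _ _) (Continuous.intervalIntegrable (by fun_prop) _ _),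
    this, gI, mul_sub]
  congr 1
  field_simp

open Real in
lemma gI_hasSum (s : ℝ) :
    HasSum (fun n : ℕ => (-1)^n * s^(n+1) * ((2*n+2).choose n : ℝ) * n.factorial / ((n+1).factorial^2 * 4^(n+1)))
      (1 - gI s) := by
  let f : ℕ → ℝ → ℝ := fun n x => cos x ^ 2 * ((-1)^n * (sin x ^ 2 * s)^(n+1) / (n+1).factorial)
  have hl : ∀ x, HasSum (fun n => f n x) (cos x ^ 2 * (1 - exp (-(sin x ^ 2 * s)))) := by
    intro x
    have h := NormedSpace.expSeries_div_hasSum_exp (-(sin x ^ 2 * s))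
    rw [← Real.exp_eq_exp_ℝ] at h
    have h2 := (hasSum_nat_add_iff' 1).2 h
    convert! (h2.neg).mul_left (cos x ^ 2) using 1
    · funext n; simp only [f]; rw [neg_pow (sin x ^ 2 * s)]; ring
    · simp
  have hb : ∀ n x, ‖f n x‖ ≤ |s|^(n+1) / (n+1).factorial := by
    intro n x
    simp only [f]
    rw [norm_mul, norm_div, norm_mul, norm_pow (-1:ℝ), norm_neg, norm_one, one_pow, one_mul, norm_pow (_ * _), norm_mul,
      Real.norm_eq_abs s, Real.norm_natCast, Real.norm_of_nonneg (sq_nonneg _), Real.norm_of_nonneg (sq_nonneg _)]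
    have h1 : cos x ^ 2 ≤ 1 := cos_sq_le_one x
    have h2 : sin x ^ 2 ≤ 1 := sin_sq_le_one x
    calc _ ≤ 1 * ((1 * |s|)^(n+1) / ((n+1).factorial : ℝ)) := by gcongr
      _ = _ := by simp
  have hsum : Summable fun n : ℕ => |s|^(n+1) / ((n+1).factorial : ℝ) :=
    (summable_nat_add_iff 1).2 (Real.summable_pow_div_factorial |s|)
  have H := intervalIntegral.hasSum_integral_of_dominated_convergence (a := 0) (b := π) (μ := volume)
    (F := f) (f := fun x => cos x ^ 2 * (1 - exp (-(sin x ^ 2 * s))))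
    (fun n _ => |s|^(n+1) / ((n+1).factorial : ℝ))
    (fun n => Continuous.aestronglyMeasurable (by simp only [f]; fun_prop))
    (fun n => ae_of_all _ fun x _ => hb n x)
    (ae_of_all _ fun x _ => hsum)
    (by simp)
    (ae_of_all _ fun x _ => hl x)
  rw [one_sub_gI]
  convert! H.mul_left (2/π) using 1
  funext n
  have : ∀ x, f n x = ((-1)^n * s^(n+1) / (n+1).factorial) * (cos x ^ 2 * sin x ^ (2*(n+1))) := by
    intro x; simp only [f]; rw [mul_pow, pow_mul]; ring
  simp only [this]
  rw [intervalIntegral.integral_const_mul, sin_cos_even]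
  have := Nat.factorial_pos (n+1)
  field_simp

lemma wt_laplace (t : ℝ) (ht : 0 < t) :
    ∫ x in Ioi (0:ℝ), wt x * Real.exp (-(t*x^2)) = (1 - gI (1/t))/2 := by
  refine (wt_hasSum t ht).unique ?_
  convert! (gI_hasSum (1/t)).div_const 2 using 1
  funext n
  have := Nat.factorial_pos (n+1)
  rw [bc, div_pow, one_pow]
  field_simp

open Real in
lemma gI_lt_one (s : ℝ) (hs : 0 < s) : 0 < 1 - gI s := by
  rw [one_sub_gI]
  refine mul_pos (by positivity) ?_
  refine intervalIntegral.integral_pos pi_pos (by fun_prop) ?_ ⟨π/4, ⟨by positivity, by linarith [pi_pos]⟩, ?_⟩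
  · intro x _
    refine mul_nonneg (sq_nonneg _) (sub_nonneg.2 (exp_le_one_iff.2 ?_))
    have := mul_nonneg (sq_nonneg (sin x)) hs.le
    linarith
  · rw [cos_pi_div_four, sin_pi_div_four]
    refine mul_pos (by positivity) (sub_pos.2 (exp_lt_one_iff.2 ?_))
    have : 0 < (√2/2)^2 * s := by positivity
    linarith

open Real in
lemma gI_nonneg (s : ℝ) : 0 ≤ gI s := by
  refine mul_nonneg (by positivity) (intervalIntegral.integral_nonneg pi_pos.le fun x _ => by positivity)

open Real in
lemma one_sub_gI_le (s : ℝ) (hs : 0 < s) : 1 - gI s ≤ 2 * s := by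
  rw [one_sub_gI]
  have : ∫ x in (0:ℝ)..π, cos x ^ 2 * (1 - exp (-(sin x ^ 2 * s))) ≤ ∫ x in (0:ℝ)..π, s := by
    refine intervalIntegral.integral_mono_on pi_pos.le (Continuous.intervalIntegrable (by fun_prop) _ _) (by simp) fun x _ => ?_
    have h1 : cos x ^ 2 ≤ 1 := cos_sq_le_one x
    have h2 : sin x ^ 2 ≤ 1 := sin_sq_le_one x
    have h3 := add_one_le_exp (-(sin x ^ 2 * s))
    have h4 : sin x ^ 2 * s ≤ s := by nlinarith
    have h5 : 0 ≤ cos x ^ 2 := sq_nonneg _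
    calc cos x ^ 2 * (1 - exp (-(sin x ^ 2 * s))) ≤ cos x ^ 2 * s := by gcongr; linarith
      _ ≤ s := by nlinarith
  rw [intervalIntegral.integral_const, sub_zero, smul_eq_mul] at this
  calc _ ≤ 2/π * (π * s) := by gcongr
    _ = 2 * s := by field_simp

open Real in
lemma gI_le (s : ℝ) (hs : 0 < s) : gI s ≤ 2 / √s := by
  have hq : 0 < √s := sqrt_pos.2 hs
  have hd : ∀ x, HasDerivAt (fun x => arctan (√s * sin x) / √s) (cos x / (1 + s * sin x ^ 2)) x := by
    intro x
    have := (((hasDerivAt_sin x).const_mul (√s)).arctan).div_const (√s)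
    refine this.congr_deriv ?_
    rw [mul_pow, sq_sqrt hs.le]
    field_simp
  have hpos : ∀ x, 0 < 1 + s * sin x ^ 2 := fun x => by positivity
  have hcont : Continuous fun x => cos x / (1 + s * sin x ^ 2) := by
    refine Continuous.div (by fun_prop) (by fun_prop) fun x => (hpos x).ne'
  have hFTC : ∀ a b, ∫ x in a..b, cos x / (1 + s * sin x ^ 2) = arctan (√s * sin b) / √s - arctan (√s * sin a) / √s :=
    fun a b => intervalIntegral.integral_eq_sub_of_hasDerivAt (fun x _ => hd x) (hcont.intervalIntegrable _ _)
  have hbd : ∀ x c, |cos x| = c → cos x ^ 2 * exp (-(sin x ^ 2 * s)) ≤ c / (1 + s * sin x ^ 2) := by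
    intro x c hc
    have h1 : cos x ^ 2 ≤ |cos x| := by
      rw [← sq_abs]; have := abs_cos_le_one x; have := abs_nonneg (cos x); nlinarith
    have h2 : exp (-(sin x ^ 2 * s)) ≤ 1 / (1 + s * sin x ^ 2) := by
      rw [exp_neg, ← one_div]
      refine one_div_le_one_div_of_le (hpos x) ?_
      have := add_one_le_exp (sin x ^ 2 * s); linarith
    rw [← hc]
    calc _ ≤ |cos x| * (1 / (1 + s * sin x ^ 2)) := by gcongr
      _ = _ := by ring
  have hI : ∀ a b, IntervalIntegrable (fun x => cos x ^ 2 * exp (-(sin x ^ 2 * s))) volume a b :=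
    fun a b => Continuous.intervalIntegrable (by fun_prop) _ _
  have A : ∫ x in (0:ℝ)..(π/2), cos x ^ 2 * exp (-(sin x ^ 2 * s)) ≤ (π/2)/√s := by
    calc _ ≤ ∫ x in (0:ℝ)..(π/2), cos x / (1 + s * sin x ^ 2) := by
          refine intervalIntegral.integral_mono_on (by positivity) (hI _ _) (hcont.intervalIntegrable _ _) fun x hx => hbd x _ ?_
          exact abs_of_nonneg (cos_nonneg_of_mem_Icc ⟨by linarith [hx.1, pi_pos], hx.2⟩)
      _ ≤ _ := by
          rw [hFTC]; simp
          gcongr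
          exact (arctan_lt_pi_div_two _).le
  have B : ∫ x in (π/2)..π, cos x ^ 2 * exp (-(sin x ^ 2 * s)) ≤ (π/2)/√s := by
    calc _ ≤ ∫ x in (π/2)..π, -(cos x / (1 + s * sin x ^ 2)) := by
          refine intervalIntegral.integral_mono_on (by linarith [pi_pos]) (hI _ _) (hcont.neg.intervalIntegrable _ _) fun x hx => ?_
          have := hbd x (-cos x) (abs_of_nonpos (cos_nonpos_of_pi_div_two_le_of_le hx.1 (by linarith [hx.2, pi_pos])))
          rwa [neg_div] at this
      _ ≤ _ := by
          rw [intervalIntegral.integral_neg, hFTC]; simp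
          gcongr
          exact (arctan_lt_pi_div_two _).le
  rw [gI, ← intervalIntegral.integral_add_adjacent_intervals (hI 0 (π/2)) (hI (π/2) π)]
  calc _ ≤ 2/π * ((π/2)/√s + (π/2)/√s) := by gcongr
    _ = _ := by field_simp; ring


lemma wt_exp_integrable (t : ℝ) (ht : 0 < t) :
    IntegrableOn (fun x => wt x * Real.exp (-(t*x^2))) (Ioi 0) := by
  refine Integrable.of_integral_ne_zero ?_
  rw [wt_laplace t ht]
  have := gI_lt_one (1/t) (by positivity)
  linarith

lemma wt_aesm : AEStronglyMeasurable wt (volume.restrict (Ioi 0)) := by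
  have h := (wt_exp_integrable 1 one_pos).aestronglyMeasurable
  have h2 : AEStronglyMeasurable (fun x : ℝ => Real.exp (1*x^2)) (volume.restrict (Ioi 0)) :=
    Continuous.aestronglyMeasurable (by fun_prop)
  refine (h.mul h2).congr (ae_of_all _ fun x => ?_)
  simp only [Pi.mul_apply]
  rw [mul_assoc, ← Real.exp_add]; simp

lemma gI_tendsto : Tendsto (fun n : ℕ => (1 - gI (1/(1/((n:ℝ)+1))))/2) atTop (𝓝 (1/2)) := by
  have h : Tendsto (fun n : ℕ => gI (1/(1/((n:ℝ)+1)))) atTop (𝓝 0) := by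
    have hb : Tendsto (fun n : ℕ => 2 / √((n:ℝ)+1)) atTop (𝓝 0) := by
      refine Tendsto.div_atTop tendsto_const_nhds ?_
      exact Real.tendsto_sqrt_atTop.comp (tendsto_atTop_add_const_right _ _ tendsto_natCast_atTop_atTop)
    refine squeeze_zero (fun n => gI_nonneg _) (fun n => ?_) hb
    rw [one_div_one_div]
    exact gI_le _ (by positivity)
  simpa using (h.const_sub 1).div_const 2

lemma wt_total : IntegrableOn wt (Ioi 0) ∧ ∫ x in Ioi (0:ℝ), wt x = 1/2 := by
  have hnn : 0 ≤ᵐ[volume.restrict (Ioi (0:ℝ))] wt :=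
    (ae_restrict_iff' measurableSet_Ioi).2 (ae_of_all _ fun x hx => wt_nonneg hx)
  have H := lintegral_tendsto_of_tendsto_of_monotone (μ := volume.restrict (Ioi (0:ℝ)))
    (f := fun (n:ℕ) x => ENNReal.ofReal (wt x * Real.exp (-(1/((n:ℝ)+1)*x^2))))
    (F := fun x => ENNReal.ofReal (wt x)) ?_ ?_ ?_
  · have e : ∀ n : ℕ, ∫⁻ x in Ioi (0:ℝ), ENNReal.ofReal (wt x * Real.exp (-(1/((n:ℝ)+1)*x^2))) =
        ENNReal.ofReal ((1 - gI (1/(1/((n:ℝ)+1))))/2) := by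
      intro n
      have hp : (0:ℝ) < 1/((n:ℝ)+1) := by positivity
      rw [← wt_laplace _ hp, ofReal_integral_eq_lintegral_ofReal (wt_exp_integrable _ hp)]
      filter_upwards [hnn] with x hx
      exact mul_nonneg hx (Real.exp_pos _).le
    simp only [e] at H
    have H2 := (ENNReal.continuous_ofReal.tendsto _).comp gI_tendsto
    have H3 := tendsto_nhds_unique H H2
    constructor
    · refine ⟨wt_aesm, ?_⟩
      rw [hasFiniteIntegral_iff_ofReal hnn, H3]
      exact ENNReal.ofReal_lt_top
    · rw [integral_eq_lintegral_of_nonneg_ae hnn wt_aesm, H3, ENNReal.toReal_ofReal (by norm_num)]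
  · intro n
    exact ((wt_exp_integrable _ (by positivity)).aestronglyMeasurable.aemeasurable).ennreal_ofReal
  · filter_upwards [hnn] with x hx
    intro n m hnm
    simp only
    refine ENNReal.ofReal_le_ofReal (mul_le_mul_of_nonneg_left ?_ hx)
    have : (n:ℝ) ≤ m := by exact_mod_cast hnm
    gcongr
  · refine ae_of_all _ fun x => ?_
    refine (ENNReal.continuous_ofReal.tendsto _).comp ?_
    have : Tendsto (fun n : ℕ => wt x * Real.exp (-(1/((n:ℝ)+1)*x^2))) atTop (𝓝 (wt x * Real.exp (-(0*x^2)))) := by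
      refine Tendsto.const_mul _ ((Real.continuous_exp.tendsto _).comp ?_)
      exact (tendsto_one_div_add_atTop_nhds_zero_nat.mul_const _).neg
    simpa using this

lemma fub {X : Type*} [MeasurableSpace X] (m : Measure X) [SFinite m] (k : X → ℝ → ℝ) (K : ℝ → ℝ)
    (hm : AEStronglyMeasurable (Function.uncurry k) (m.prod (volume.restrict (Ioi 0))))
    (hk : ∀ t, 0 < t → Integrable (fun x => k x t) m ∧ ∫ x, k x t ∂m = K t)
    (hs : ∀ t, 0 < t → (∀ᵐ x ∂m, 0 ≤ k x t) ∨ (∀ᵐ x ∂m, k x t ≤ 0))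
    (hK : IntegrableOn K (Ioi 0)) :
    Integrable (fun x => ∫ t in Ioi 0, k x t) m ∧
    ∫ x, (∫ t in Ioi 0, k x t) ∂m = ∫ t in Ioi 0, K t := by
  have hI : Integrable (Function.uncurry k) (m.prod (volume.restrict (Ioi 0))) := by
    rw [integrable_prod_iff' hm]
    constructor
    · exact (ae_restrict_iff' measurableSet_Ioi).2 (ae_of_all _ fun t ht => (hk t ht).1)
    · refine hK.norm.congr ?_
      refine (ae_restrict_iff' measurableSet_Ioi).2 (ae_of_all _ fun t ht => ?_)
      obtain ⟨h1, h2⟩ := hk t ht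
      simp only [Function.uncurry]
      rw [← h2]
      rcases hs t ht with h | h
      · rw [Real.norm_of_nonneg (integral_nonneg_of_ae h)]
        refine integral_congr_ae ?_
        filter_upwards [h] with x hx
        rw [Real.norm_of_nonneg hx]
      · rw [Real.norm_of_nonpos (integral_nonpos_of_ae h), ← integral_neg]
        refine integral_congr_ae ?_
        filter_upwards [h] with x hx
        rw [Real.norm_of_nonpos hx]
  refine ⟨hI.integral_prod_left, ?_⟩
  rw [integral_integral_swap hI]
  exact setIntegral_congr_fun measurableSet_Ioi fun t ht => (hk t ht).2

lemma gI_cont : Continuous gI := by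
  unfold gI
  refine continuous_const.mul ?_
  exact intervalIntegral.continuous_parametric_intervalIntegral_of_continuous' (by fun_prop) _ _

/-- second kernel -/
noncomputable def K2 (s : ℝ) : ℝ := ((if s ≤ 1 then 1 else 0) - 1 + (1 - gI s)^2)/s
/-- first kernel -/
noncomputable def K1 (t : ℝ) : ℝ := ((if t ≤ 1 then 1/4 else 0) - ((1 - gI (1/t))/2)^2)/t

lemma K2_integrable : IntegrableOn K2 (Ioi 0) := by
  have hm : Measurable K2 := by
    have := gI_cont.measurable
    unfold K2
    refine Measurable.div ?_ measurable_id
    refine Measurable.add (Measurable.sub (Measurable.ite measurableSet_Iic measurable_const measurable_const) measurable_const) (by fun_prop)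
  rw [← Ioc_union_Ioi_eq_Ioi (zero_le_one (α := ℝ))]
  refine IntegrableOn.union ?_ ?_
  · refine Measure.integrableOn_of_bounded (M := 4) (by simp) hm.aestronglyMeasurable ?_
    refine (ae_restrict_iff' measurableSet_Ioc).2 (ae_of_all _ fun s hs => ?_)
    have h1 := gI_lt_one s hs.1
    have h2 := one_sub_gI_le s hs.1
    rw [K2, if_pos hs.2, Real.norm_of_nonneg (div_nonneg (by nlinarith) hs.1.le), div_le_iff₀ hs.1]
    nlinarith [hs.1, hs.2]
  · have hi : IntegrableOn (fun s : ℝ => 4 * s^(-(3/2):ℝ)) (Ioi 1) :=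
      (integrableOn_Ioi_rpow_of_lt (by norm_num) one_pos).const_mul 4
    refine Integrable.mono' hi hm.aestronglyMeasurable ?_
    refine (ae_restrict_iff' measurableSet_Ioi).2 (ae_of_all _ fun s hs => ?_)
    have hs1 : (1:ℝ) < s := hs
    have hs0 : 0 < s := by linarith
    have h1 := gI_lt_one s hs0
    have h2 := gI_nonneg s
    have h3 := gI_le s hs0
    have e : (4:ℝ) * s^(-(3/2):ℝ) = 2 * (2/√s) / s := by
      rw [show (-(3/2):ℝ) = -(1/2) + -1 by norm_num, Real.rpow_add hs0, Real.rpow_neg hs0.le,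
        Real.rpow_neg_one, ← Real.sqrt_eq_rpow]
      field_simp; ring
    rw [K2, if_neg (not_le.2 hs1), e, norm_div, Real.norm_of_nonneg hs0.le]
    gcongr
    rw [Real.norm_of_nonpos (by nlinarith)]
    nlinarith

lemma K1_K2 : ∀ᵐ s ∂(volume.restrict (Ioi (0:ℝ))),
    (|(-1:ℝ)| * s^((-1:ℝ)-1)) • K1 (s^(-1:ℝ)) = -(1/4) * K2 s := by
  have h1 : ∀ᵐ s ∂(volume.restrict (Ioi (0:ℝ))), s ≠ 1 := by
    refine ae_restrict_of_ae ?_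
    simp [ae_iff]
  filter_upwards [h1, self_mem_ae_restrict measurableSet_Ioi] with s hs1 hs
  have hs0 : (0:ℝ) < s := hs
  rw [show ((-1:ℝ)-1) = -2 by norm_num, Real.rpow_neg_one, Real.rpow_neg hs0.le, Real.rpow_two, K1, K2]
  have e : (1 / s⁻¹) = s := by simp
  rw [e]
  rcases lt_or_gt_of_ne hs1 with h | h
  · rw [if_pos h.le, if_neg (not_le.2 ((one_lt_inv₀ hs0).2 h))]
    simp; field_simp; ring
  · rw [if_neg (not_le.2 h), if_pos (inv_le_one_of_one_le₀ h.le)]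
    simp; field_simp; ring

lemma K1_integral : IntegrableOn K1 (Ioi 0) ∧ ∫ t in Ioi (0:ℝ), K1 t = -(1/4) * ∫ s in Ioi (0:ℝ), K2 s := by
  constructor
  · rw [← integrableOn_Ioi_comp_rpow_iff K1 (p := -1) (by norm_num)]
    exact (K2_integrable.const_mul (-(1/4))).congr (K1_K2.mono fun s h => h.symm)
  · rw [← integral_comp_rpow_Ioi K1 (p := -1) (by norm_num), integral_congr_ae K1_K2, integral_const_mul]

lemma ker_meas : Measurable (Function.uncurry ker) := by
  unfold ker Function.uncurry
  refine Measurable.div (Measurable.sub (Measurable.ite (measurable_snd measurableSet_Iic) measurable_const measurable_const) (by fun_prop)) measurable_snd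


lemma step1 :
    ∫ x in Ioi (0:ℝ), ∫ y in Ioi (0:ℝ),
        besselJ 1 x ^ 2 * besselJ 1 y ^ 2 / (x*y) * Real.log (x^2 + y^2)
      = -(1/4) * (∫ s in Ioi (0:ℝ), K2 s) - Real.eulerMascheroniConstant / 4 := by
  set ρ := volume.restrict (Ioi (0:ℝ)) with hρ
  have hw := wt_total.1
  have hpos : ∀ᵐ z ∂(ρ.prod ρ), 0 < z.1 ∧ 0 < z.2 := by
    rw [hρ, Measure.prod_restrict]
    filter_upwards [self_mem_ae_restrict (measurableSet_Ioi.prod measurableSet_Ioi)] with z hz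
    exact hz
  have hww : Integrable (fun z : ℝ × ℝ => wt z.1 * wt z.2) (ρ.prod ρ) := hw.mul_prod hw
  have hwwi : ∫ z : ℝ × ℝ, wt z.1 * wt z.2 ∂(ρ.prod ρ) = 1/4 := by
    rw [integral_prod_mul wt wt, wt_total.2]; norm_num
  have hwe : ∀ t, 0 < t → Integrable (fun z : ℝ × ℝ => (wt z.1 * Real.exp (-(t*z.1^2))) * (wt z.2 * Real.exp (-(t*z.2^2)))) (ρ.prod ρ) :=
    fun t ht => (wt_exp_integrable t ht).mul_prod (wt_exp_integrable t ht)
  have hwei : ∀ t, 0 < t → ∫ z : ℝ × ℝ, (wt z.1 * Real.exp (-(t*z.1^2))) * (wt z.2 * Real.exp (-(t*z.2^2))) ∂(ρ.prod ρ) = ((1 - gI (1/t))/2)^2 := by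
    intro t ht
    rw [integral_prod_mul (fun x => wt x * Real.exp (-(t*x^2))) (fun x => wt x * Real.exp (-(t*x^2))), wt_laplace t ht, sq]
  have hker : ∀ (z : ℝ × ℝ) t, wt z.1 * wt z.2 * ker (z.1^2+z.2^2) t =
      ((wt z.1 * wt z.2) * (if t ≤ 1 then 1 else 0) - (wt z.1 * Real.exp (-(t*z.1^2))) * (wt z.2 * Real.exp (-(t*z.2^2)))) / t := by
    intro z t
    rw [ker, show -((z.1^2+z.2^2)*t) = -(t*z.1^2) + -(t*z.2^2) by ring, Real.exp_add]
    ring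
  have F := fub (ρ.prod ρ) (fun z t => wt z.1 * wt z.2 * ker (z.1^2+z.2^2) t) K1 ?_ ?_ ?_ K1_integral.1
  · obtain ⟨F1, F2⟩ := F
    have e : ∀ᵐ z ∂(ρ.prod ρ), (∫ t in Ioi (0:ℝ), wt z.1 * wt z.2 * ker (z.1^2+z.2^2) t) - Real.eulerMascheroniConstant * (wt z.1 * wt z.2) =
        besselJ 1 z.1 ^ 2 * besselJ 1 z.2 ^ 2 / (z.1*z.2) * Real.log (z.1^2 + z.2^2) := by
      filter_upwards [hpos] with z hz
      have h1 := hz.1; have h2 := hz.2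
      rw [integral_const_mul, (ker_integral _ (by positivity)).2, wt, wt]
      field_simp
      ring
    have hI := F1.sub (hww.const_mul Real.eulerMascheroniConstant)
    have hI2 := hI.congr e
    have := integral_prod _ hI2
    rw [← this, ← integral_congr_ae e, integral_sub F1 (hww.const_mul _), F2, integral_const_mul, hwwi, K1_integral.2]
    ring
  · refine AEStronglyMeasurable.mul ?_ ?_
    · exact (hww.aestronglyMeasurable).comp_fst
    · refine Measurable.aestronglyMeasurable ?_
      exact ker_meas.comp (g := Function.uncurry ker) (f := fun a : (ℝ × ℝ) × ℝ => (a.1.1^2+a.1.2^2, a.2)) (by fun_prop)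
  · intro t ht
    simp only [hker]
    refine ⟨((hww.mul_const _).sub (hwe t ht)).div_const _, ?_⟩
    rw [integral_div, integral_sub (hww.mul_const _) (hwe t ht), integral_mul_const, hwwi, hwei t ht, K1]
    split_ifs <;> simp
  · intro t ht
    by_cases h : t ≤ 1
    · left
      filter_upwards [hpos] with z hz
      refine mul_nonneg (mul_nonneg (wt_nonneg hz.1) (wt_nonneg hz.2)) (div_nonneg ?_ ht.le)
      rw [if_pos h]
      refine sub_nonneg.2 (Real.exp_le_one_iff.2 ?_)
      have : 0 ≤ (z.1^2+z.2^2)*t := by positivity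
      linarith
    · right
      filter_upwards [hpos] with z hz
      refine mul_nonpos_of_nonneg_of_nonpos (mul_nonneg (wt_nonneg hz.1) (wt_nonneg hz.2)) (div_nonpos_of_nonpos_of_nonneg ?_ ht.le)
      rw [if_neg h, zero_sub]
      exact neg_nonpos.2 (Real.exp_pos _).le

open Real in
lemma step2 :
    ∫ a in Ioo (0:ℝ) π, ∫ b in Ioo (0:ℝ) π, cos a ^ 2 * cos b ^ 2 *
      (eulerMascheroniConstant + log (sin a ^ 2) + log (sin b ^ 2) - log (sin a ^ 2 + sin b ^ 2))
      = (π/2)^2 * ∫ s in Ioi (0:ℝ), K2 s := by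
  set ρ := volume.restrict (Ioo (0:ℝ) π) with hρ
  have hpos : ∀ᵐ z ∂(ρ.prod ρ), 0 < sin z.1 ∧ 0 < sin z.2 := by
    rw [hρ, Measure.prod_restrict]
    filter_upwards [self_mem_ae_restrict (measurableSet_Ioo.prod measurableSet_Ioo)] with z hz
    exact ⟨sin_pos_of_mem_Ioo hz.1, sin_pos_of_mem_Ioo hz.2⟩
  have hci : ∀ f : ℝ → ℝ, Continuous f → Integrable f ρ := fun f hf =>
    (hf.continuousOn.integrableOn_Icc).mono_set Ioo_subset_Icc_self
  have hcv : ∀ f : ℝ → ℝ, ∫ x, f x ∂ρ = ∫ x in (0:ℝ)..π, f x := fun f => by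
    rw [intervalIntegral.integral_of_le pi_pos.le, integral_Ioc_eq_integral_Ioo]
  have hcos : ∫ x, cos x ^ 2 ∂ρ = π/2 := by rw [hcv, integral_cos_sq]; simp
  have hg : ∀ s, ∫ x, cos x ^ 2 * (1 - exp (-(sin x ^ 2 * s))) ∂ρ = (π/2) * (1 - gI s) := by
    intro s; rw [hcv, one_sub_gI, ← mul_assoc, show π/2*(2/π) = 1 by field_simp, one_mul]
  have hker : ∀ (z : ℝ × ℝ) s, cos z.1 ^ 2 * cos z.2 ^ 2 * (ker (sin z.1 ^ 2) s + ker (sin z.2 ^ 2) s - ker (sin z.1 ^ 2 + sin z.2 ^ 2) s) =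
      ((cos z.1 ^ 2 * cos z.2 ^ 2) * ((if s ≤ 1 then 1 else 0) - 1) + (cos z.1 ^ 2 * (1 - exp (-(sin z.1 ^ 2 * s)))) * (cos z.2 ^ 2 * (1 - exp (-(sin z.2 ^ 2 * s))))) / s := by
    intro z s
    rw [ker, ker, ker, show -((sin z.1 ^ 2 + sin z.2 ^ 2) * s) = -(sin z.1 ^ 2 * s) + -(sin z.2 ^ 2 * s) by ring, exp_add]
    ring
  have hcc : Integrable (fun z : ℝ × ℝ => cos z.1 ^ 2 * cos z.2 ^ 2) (ρ.prod ρ) :=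
    (hci (fun x => cos x ^ 2) (by fun_prop)).mul_prod (hci (fun x => cos x ^ 2) (by fun_prop))
  have hcci : ∫ z : ℝ × ℝ, cos z.1 ^ 2 * cos z.2 ^ 2 ∂(ρ.prod ρ) = (π/2)^2 := by
    rw [integral_prod_mul (fun x => cos x ^ 2) (fun x => cos x ^ 2), hcos, sq]
  have hwe : ∀ s, Integrable (fun z : ℝ × ℝ => (cos z.1 ^ 2 * (1 - exp (-(sin z.1 ^ 2 * s)))) * (cos z.2 ^ 2 * (1 - exp (-(sin z.2 ^ 2 * s))))) (ρ.prod ρ) :=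
    fun s => (hci (fun x => cos x ^ 2 * (1 - exp (-(sin x ^ 2 * s)))) (by fun_prop)).mul_prod
      (hci (fun x => cos x ^ 2 * (1 - exp (-(sin x ^ 2 * s)))) (by fun_prop))
  have hwei : ∀ s, ∫ z : ℝ × ℝ, (cos z.1 ^ 2 * (1 - exp (-(sin z.1 ^ 2 * s)))) * (cos z.2 ^ 2 * (1 - exp (-(sin z.2 ^ 2 * s)))) ∂(ρ.prod ρ) = (π/2)^2 * (1 - gI s)^2 := by
    intro s
    rw [integral_prod_mul (fun x => cos x ^ 2 * (1 - exp (-(sin x ^ 2 * s)))) (fun x => cos x ^ 2 * (1 - exp (-(sin x ^ 2 * s)))), hg]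
    ring
  have hnn : ∀ x s : ℝ, 0 < s → 0 ≤ 1 - exp (-(sin x ^ 2 * s)) := by
    intro x s hs
    refine sub_nonneg.2 (exp_le_one_iff.2 ?_)
    have : 0 ≤ sin x ^ 2 * s := by positivity
    linarith
  have F := fub (ρ.prod ρ) (fun z s => cos z.1 ^ 2 * cos z.2 ^ 2 * (ker (sin z.1 ^ 2) s + ker (sin z.2 ^ 2) s - ker (sin z.1 ^ 2 + sin z.2 ^ 2) s)) (fun s => (π/2)^2 * K2 s) ?_ ?_ ?_ (K2_integrable.const_mul _)
  · obtain ⟨F1, F2⟩ := F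
    have e : ∀ᵐ z ∂(ρ.prod ρ), (∫ s in Ioi (0:ℝ), cos z.1 ^ 2 * cos z.2 ^ 2 * (ker (sin z.1 ^ 2) s + ker (sin z.2 ^ 2) s - ker (sin z.1 ^ 2 + sin z.2 ^ 2) s)) =
        cos z.1 ^ 2 * cos z.2 ^ 2 *
      (eulerMascheroniConstant + log (sin z.1 ^ 2) + log (sin z.2 ^ 2) - log (sin z.1 ^ 2 + sin z.2 ^ 2)) := by
      filter_upwards [hpos] with z hz
      have h1 := hz.1; have h2 := hz.2
      have k1 := ker_integral (sin z.1 ^ 2) (by positivity)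
      have k2 := ker_integral (sin z.2 ^ 2) (by positivity)
      have k3 := ker_integral (sin z.1 ^ 2 + sin z.2 ^ 2) (by positivity)
      have k12 : Integrable (fun s => ker (sin z.1^2) s + ker (sin z.2^2) s) (volume.restrict (Ioi 0)) := k1.1.add k2.1
      rw [integral_const_mul, integral_sub k12 k3.1, integral_add k1.1 k2.1, k1.2, k2.2, k3.2]
      ring
    have := integral_prod _ (F1.congr e)
    rw [← this, ← integral_congr_ae e, F2, integral_const_mul]
  · refine Measurable.aestronglyMeasurable ?_
    have m1 : Measurable (fun a : (ℝ × ℝ) × ℝ => ker (sin a.1.1 ^ 2) a.2) :=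
      ker_meas.comp (g := Function.uncurry ker) (f := fun a : (ℝ × ℝ) × ℝ => (sin a.1.1^2, a.2)) (by fun_prop)
    have m2 : Measurable (fun a : (ℝ × ℝ) × ℝ => ker (sin a.1.2 ^ 2) a.2) :=
      ker_meas.comp (g := Function.uncurry ker) (f := fun a : (ℝ × ℝ) × ℝ => (sin a.1.2^2, a.2)) (by fun_prop)
    have m3 : Measurable (fun a : (ℝ × ℝ) × ℝ => ker (sin a.1.1 ^ 2 + sin a.1.2 ^ 2) a.2) :=
      ker_meas.comp (g := Function.uncurry ker) (f := fun a : (ℝ × ℝ) × ℝ => (sin a.1.1^2 + sin a.1.2^2, a.2)) (by fun_prop)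
    exact Measurable.mul (by fun_prop) ((m1.add m2).sub m3)
  · intro s hs
    simp only [hker]
    refine ⟨((hcc.mul_const _).add (hwe s)).div_const _, ?_⟩
    rw [integral_div, integral_add (hcc.mul_const _) (hwe s), integral_mul_const, hcci, hwei s, K2]
    ring
  · intro s hs
    simp only [hker]
    by_cases h : s ≤ 1
    · left
      refine ae_of_all _ fun z => div_nonneg ?_ hs.le
      have := hnn z.1 s hs; have := hnn z.2 s hs
      rw [if_pos h, sub_self, mul_zero, zero_add]
      positivity
    · right
      refine ae_of_all _ fun z => div_nonpos_of_nonpos_of_nonneg ?_ hs.le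
      have h1 := hnn z.1 s hs; have h2 := hnn z.2 s hs
      have h3 : (1 - exp (-(sin z.1 ^ 2 * s))) * (1 - exp (-(sin z.2 ^ 2 * s))) ≤ 1 :=
        mul_le_one₀ (by linarith [exp_pos (-(sin z.1 ^ 2 * s))]) h2 (by linarith [exp_pos (-(sin z.2 ^ 2 * s))])
      rw [if_neg h]
      have h4 : 0 ≤ cos z.1 ^ 2 * cos z.2 ^ 2 := by positivity
      nlinarith


open Real in
lemma cosLogSin_integrable : IntervalIntegrable (fun b => cos b ^ 2 * log (sin b ^ 2)) volume 0 π := by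
  have h : IntervalIntegrable (fun b => (2 * cos b ^ 2) * log (sin b)) volume 0 π :=
    (intervalIntegrable_log_sin (a := 0) (b := π)).continuousOn_mul (by fun_prop)
  refine h.congr ?_
  intro b _
  simp only [log_pow]; push_cast; ring

open Real in
lemma cosLogSin : ∫ b in (0:ℝ)..π, cos b ^ 2 * log (sin b ^ 2) = - π * log 2 - π / 2 := by
  have hl : IntervalIntegrable (fun b => log (sin b)) volume 0 π := intervalIntegrable_log_sin
  have h1 : IntervalIntegrable (fun b => (2 * cos b ^ 2 - 1) * log (sin b)) volume 0 π :=
    hl.continuousOn_mul (by fun_prop)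
  have h2 : IntervalIntegrable (fun b : ℝ => cos b ^ 2) volume 0 π :=
    Continuous.intervalIntegrable (by fun_prop) _ _
  have e : ∫ b in (0:ℝ)..π, ((2 * cos b ^ 2 - 1) * log (sin b) + cos b ^ 2) =
      cos π * (sin π * log (sin π)) - cos 0 * (sin 0 * log (sin 0)) := by
    refine intervalIntegral.integral_eq_sub_of_hasDerivAt_of_le (f := fun b => cos b * (sin b * log (sin b))) pi_pos.le ?_ ?_ (h1.add h2)
    · exact (continuous_cos.mul (continuous_mul_log.comp continuous_sin)).continuousOn
    · intro b hb
      have hs := sin_pos_of_mem_Ioo hb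
      have := (hasDerivAt_cos b).mul ((hasDerivAt_sin b).mul ((hasDerivAt_sin b).log hs.ne'))
      convert! this using 1
      simp only [Pi.mul_apply]
      field_simp
      linear_combination (log (sin b)) * sin_sq_add_cos_sq b
  have e2 : ∫ b in (0:ℝ)..π, cos b ^ 2 = π/2 := by rw [integral_cos_sq]; simp
  rw [intervalIntegral.integral_add h1 h2, e2] at e
  simp only [sin_pi, sin_zero, zero_mul, mul_zero, sub_zero] at e
  have e3 : ∫ b in (0:ℝ)..π, cos b ^ 2 * log (sin b ^ 2) = ∫ b in (0:ℝ)..π, (log (sin b) + (2 * cos b ^ 2 - 1) * log (sin b)) := by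
    congr 1; ext b; simp only [log_pow]; push_cast; ring
  rw [e3, intervalIntegral.integral_add hl h1, integral_log_sin_zero_pi]
  linarith

open Real in
lemma int_cos_two (k : ℤ) (hk : k ≠ 0) : ∫ b in (0:ℝ)..π, cos (2 * k * b) = 0 := by
  have : (2 * (k:ℝ)) ≠ 0 := by positivity
  rw [intervalIntegral.integral_comp_mul_left _ this, integral_cos]
  have : sin (2 * k * π) = 0 := by
    have := sin_int_mul_pi (2*k); push_cast at this; exact this
  simp [this]

open Real in
lemma int_cosq_cos (n : ℕ) (hn : 1 ≤ n) : ∫ b in (0:ℝ)..π, cos b ^ 2 * cos (2 * n * b) = if n = 1 then π/4 else 0 := by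
  have e : ∀ b : ℝ, cos b ^ 2 * cos (2 * n * b) = 1/2 * cos (2 * (n:ℤ) * b) + 1/4 * cos (2 * ((n+1:ℤ)) * b) + 1/4 * cos (2 * ((n-1:ℤ)) * b) := by
    intro b
    have h1 := cos_sub (2*n*b) (2*b)
    have h2 := cos_add (2*n*b) (2*b)
    push_cast
    rw [show 2 * ((n:ℝ)+1) * b = 2*n*b+2*b by ring, show 2 * ((n:ℝ)-1) * b = 2*n*b-2*b by ring, h1, h2, cos_two_mul]
    ring
  have hc : ∀ c k : ℝ, IntervalIntegrable (fun b => c * cos (k * b)) volume 0 π :=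
    fun c k => Continuous.intervalIntegrable (by fun_prop) _ _
  simp only [e]
  push_cast
  rw [intervalIntegral.integral_add ((hc _ _).add (hc _ _)) (hc _ _), intervalIntegral.integral_add (hc _ _) (hc _ _),
    intervalIntegral.integral_const_mul, intervalIntegral.integral_const_mul, intervalIntegral.integral_const_mul]
  have a1 := int_cos_two n (by omega)
  have a2 := int_cos_two (n+1) (by omega)
  push_cast at a1 a2
  rw [a1, a2]
  split_ifs with h
  · subst h; simp; ring
  · have a3 := int_cos_two (n-1) (by omega)
    push_cast at a3
    rw [a3]; simp

open Real in
lemma poisson_log (q : ℝ) (hq : 0 < q) (hq1 : q < 1) :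
    ∫ b in (0:ℝ)..π, cos b ^ 2 * log (1 - 2 * q * cos (2*b) + q^2) = - (π/2) * q := by
  have hs : ∀ b : ℝ, HasSum (fun n : ℕ => -2 * (q^n / n) * (cos b ^ 2 * cos (2 * n * b))) (cos b ^ 2 * log (1 - 2 * q * cos (2*b) + q^2)) := by
    intro b
    set z : ℂ := q * Complex.exp ((2*b : ℝ) * Complex.I) with hz
    have hzn : ‖z‖ = q := by rw [hz, norm_mul, Complex.norm_exp_ofReal_mul_I]; simp [abs_of_pos hq]
    have h := Complex.hasSum_re (Complex.hasSum_taylorSeries_neg_log (z := z) (by rw [hzn]; exact hq1))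
    have h2 : 1 - 2 * q * cos (2*b) + q^2 = ‖1 - z‖^2 := by
      rw [← Complex.normSq_eq_norm_sq, Complex.normSq_apply, hz, Complex.exp_mul_I, ← Complex.ofReal_cos, ← Complex.ofReal_sin]
      simp only [Complex.sub_re, Complex.sub_im, Complex.re_ofReal_mul, Complex.im_ofReal_mul, Complex.add_re, Complex.add_im, Complex.ofReal_re, Complex.ofReal_im, Complex.I_re, Complex.I_im, Complex.one_re, Complex.one_im]
      linear_combination (-q^2) * sin_sq_add_cos_sq (2*b)
    have h3 := h.mul_left (-2 * cos b ^ 2)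
    convert! h3 using 1
    · ext n
      have : (z^n / n).re = q^n/n * cos (2*n*b) := by
        rw [hz, mul_pow, ← Complex.exp_nat_mul, ← mul_assoc, show ((n:ℂ) * ((2*b:ℝ):ℂ)) = ((2*n*b : ℝ) : ℂ) by push_cast; ring, Complex.exp_mul_I, ← Complex.ofReal_cos, ← Complex.ofReal_sin]
        rw [show ((q:ℂ)^n * (((cos (2*n*b) : ℝ):ℂ) + ((sin (2*n*b) : ℝ):ℂ) * Complex.I) / n) = (((q^n/n : ℝ):ℂ) * (((cos (2*n*b) : ℝ):ℂ) + ((sin (2*n*b) : ℝ):ℂ) * Complex.I)) by push_cast; ring]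
        rw [Complex.re_ofReal_mul, Complex.add_re, Complex.re_ofReal_mul, Complex.ofReal_re, Complex.I_re, mul_zero, add_zero]
      rw [this]; ring
    · rw [h2, Complex.neg_re, Complex.log_re, log_pow]; push_cast; ring
  have H := intervalIntegral.hasSum_integral_of_dominated_convergence (μ := volume) (a := 0) (b := π)
    (F := fun (n : ℕ) b => -2 * (q^n / n) * (cos b ^ 2 * cos (2 * n * b))) (f := fun b => cos b ^ 2 * log (1 - 2 * q * cos (2*b) + q^2))
    (fun n _ => 2 * q^n) ?_ ?_ ?_ ?_ ?_
  · have H2 : HasSum (fun n : ℕ => ∫ b in (0:ℝ)..π, -2 * (q^n / n) * (cos b ^ 2 * cos (2 * n * b))) (- (π/2) * q) := by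
      convert! hasSum_single (f := fun n : ℕ => ∫ b in (0:ℝ)..π, -2 * (q^n / n) * (cos b ^ 2 * cos (2 * n * b))) 1 ?_ using 1
      · rw [intervalIntegral.integral_const_mul, int_cosq_cos 1 le_rfl]; simp; ring
      · intro n hn
        rw [intervalIntegral.integral_const_mul]
        rcases Nat.eq_zero_or_pos n with h0 | h0
        · simp [h0]
        · rw [int_cosq_cos n h0]; simp [hn]
    exact H.unique H2
  · intro n
    exact (Continuous.aestronglyMeasurable (by fun_prop))
  · intro n
    refine ae_of_all _ fun b _ => ?_
    rw [norm_mul, norm_mul, norm_mul]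
    have h1 : ‖cos b ^ 2‖ ≤ 1 := by rw [norm_pow]; exact pow_le_one₀ (norm_nonneg _) (abs_cos_le_one b)
    have h2 : ‖cos (2*n*b)‖ ≤ 1 := abs_cos_le_one _
    have h3 : ‖q^n/n‖ ≤ q^n := by
      rw [norm_of_nonneg (by positivity)]
      rcases Nat.eq_zero_or_pos n with h0 | h0
      · simp [h0]
      · exact div_le_self (by positivity) (by exact_mod_cast h0)
    have h4 : ‖(-2:ℝ)‖ = 2 := by simp
    rw [h4]
    calc 2 * ‖q^n/n‖ * (‖cos b ^ 2‖ * ‖cos (2*n*b)‖) ≤ 2 * q^n * (1 * 1) := by gcongr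
      _ = 2 * q^n := by ring
  · exact ae_of_all _ fun b _ => (summable_geometric_of_lt_one hq.le hq1).mul_left 2
  · simp
  · exact ae_of_all _ fun b _ => hs b

open Real in
lemma inner_log (S : ℝ) (hS : 0 < S) :
    ∫ b in (0:ℝ)..π, cos b ^ 2 * log (S^2 + sin b ^ 2)
      = (π/2) * (- 2 * log 2 + 2 * arsinh S - (1 + 2 * S^2 - 2 * S * √(1+S^2))) := by
  set R := √(1+S^2) with hR
  have hR2 : R^2 = 1+S^2 := sq_sqrt (by positivity)
  have hRp : 0 < R := by positivity
  have hd : 0 < R - S := by nlinarith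
  have hd1 : R - S < 1 := by nlinarith
  set q := (R-S)^2 with hq
  have hq0 : 0 < q := by positivity
  have hq1 : q < 1 := by nlinarith
  have hqe : q = 1 + 2 * S^2 - 2 * S * R := by rw [hq]; nlinarith
  have hlq : log q = - 2 * arsinh S := by
    have : R - S = (S + R)⁻¹ := by
      exact eq_inv_of_mul_eq_one_left (by nlinarith)
    rw [hq, this, log_pow, log_inv, arsinh]; push_cast; ring
  have e : ∀ b : ℝ, cos b ^ 2 * log (S^2 + sin b ^ 2) = cos b ^ 2 * log (1 - 2 * q * cos (2*b) + q^2) + (-2 * log 2 - log q) * cos b ^ 2 := by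
    intro b
    have h1 : 1 - 2 * q * cos (2*b) + q^2 = 2^2 * q * (S^2 + sin b ^ 2) := by
      have h2 : (1-q)^2 = 4 * q * S^2 := by
        have : 1 - q = 2 * S * (R-S) := by rw [hqe]; ring
        rw [this, hq]; ring
      have h3 := sin_sq_add_cos_sq b
      rw [cos_two_mul]
      have : cos b ^ 2 = 1 - sin b ^ 2 := by linarith
      rw [this]; linarith
    have hp : 0 < S^2 + sin b ^ 2 := by positivity
    rw [h1, log_mul (by positivity) hp.ne', log_mul (by positivity) hq0.ne', log_pow]
    push_cast; ring
  simp only [e]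
  rw [intervalIntegral.integral_add, poisson_log q hq0 hq1, intervalIntegral.integral_const_mul, integral_cos_sq, hlq, ← hqe]
  · simp; ring
  · refine Continuous.intervalIntegrable ?_ _ _
    refine Continuous.mul (by fun_prop) (Continuous.log (by fun_prop) fun b => ?_)
    have : 1 - 2 * q * cos (2*b) + q^2 = (1-q)^2 + 2*q*(1 - cos (2*b)) := by ring
    have h1 := cos_le_one (2*b)
    have h2 : 0 < (1-q)^2 := by have : 0 < 1 - q := by linarith
                                positivity
    have h3 : 0 ≤ 2*q*(1 - cos (2*b)) := mul_nonneg (by positivity) (by linarith)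
    rw [this]; linarith
  · exact Continuous.intervalIntegrable (by fun_prop) _ _

open Real in
lemma arctan_deriv (t a : ℝ) : HasDerivAt (fun a => arctan (t * cos a / √(1 + t^2 * sin a ^ 2))) (- (t * sin a / √(1 + t^2 * sin a ^ 2))) a := by
  have hp : 0 < 1 + t^2 * sin a ^ 2 := by positivity
  have hw0 : 0 < √(1 + t^2 * sin a ^ 2) := by positivity
  have hw : HasDerivAt (fun a => √(1 + t^2 * sin a ^ 2)) _ a :=
    ((((hasDerivAt_sin a).pow 2).const_mul (t^2)).const_add 1).sqrt hp.ne'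
  have h := ((((hasDerivAt_cos a).const_mul t).div hw hw0.ne')).arctan
  refine h.congr_deriv ?_
  simp only [Pi.pow_apply, Pi.div_apply]
  have hw2 : √(1 + t^2 * sin a ^ 2) ^ 2 = 1 + t^2 * sin a ^ 2 := sq_sqrt hp.le
  set w := √(1 + t^2 * sin a ^ 2)
  have hc : cos a ^ 2 = 1 - sin a ^ 2 := by linarith [sin_sq_add_cos_sq a]
  have h1 : 0 < w^2 + (t * cos a)^2 := by positivity
  have h2 : w^2 + (t * cos a)^2 = 1 + t^2 := by rw [hw2, mul_pow, hc]; ring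
  have h3 : 0 < 1 + t^2 := by positivity
  have h4 : 1 + (t * cos a / w)^2 = (1+t^2)/w^2 := by rw [← h2]; field_simp
  rw [h4]
  field_simp
  norm_num
  linear_combination (-2 * t * sin a) * h2

open Real in
lemma int_sin_div (t : ℝ) (ht : 0 < t) : ∫ a in (0:ℝ)..π, sin a / √(1 + t^2 * sin a ^ 2) = 2 * (arctan t / t) := by
  have h := intervalIntegral.integral_eq_sub_of_hasDerivAt (a := 0) (b := π) (fun a _ => arctan_deriv t a)
    (Continuous.intervalIntegrable (by
      refine Continuous.neg (Continuous.div (by fun_prop) (by fun_prop) fun a => ?_)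
      positivity) _ _)
  have e : ∀ a, -(t * sin a / √(1 + t^2 * sin a ^ 2)) = (-t) * (sin a / √(1 + t^2 * sin a ^ 2)) := fun a => by ring
  simp only [e] at h
  rw [intervalIntegral.integral_const_mul] at h
  simp [arctan_neg] at h
  rw [← mul_div_assoc, eq_div_iff ht.ne']
  linarith

open Real in
lemma w_deriv (a : ℝ) : HasDerivAt (fun a => √(1 + sin a ^ 2)) (sin a * cos a / √(1 + sin a ^ 2)) a := by
  have hp : 0 < 1 + sin a ^ 2 := by positivity
  have hw : HasDerivAt (fun a => √(1 + sin a ^ 2)) _ a :=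
    (((hasDerivAt_sin a).pow 2).const_add 1).sqrt hp.ne'
  refine hw.congr_deriv ?_
  have hw0 : 0 < √(1 + sin a ^ 2) := by positivity
  simp only [Pi.pow_apply]
  field_simp
  norm_num
  ring

open Real in
lemma theta_deriv (a : ℝ) : HasDerivAt (fun a => arctan (cos a / √(1 + sin a ^ 2))) (- (sin a / √(1 + sin a ^ 2))) a := by
  simpa using arctan_deriv 1 a

open Real in
lemma int_scc : ∫ a in (0:ℝ)..π, sin a * cos a ^ 2 / √(1 + sin a ^ 2) = π/2 - 1 := by
  have h := intervalIntegral.integral_eq_sub_of_hasDerivAt (a := 0) (b := π)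
    (f := fun a => - arctan (cos a / √(1 + sin a ^ 2)) + cos a * √(1 + sin a ^ 2) / 2)
    (f' := fun a => sin a * cos a ^ 2 / √(1 + sin a ^ 2)) (fun a _ => by
      refine ((theta_deriv a).neg.add (((hasDerivAt_cos a).mul (w_deriv a)).div_const 2)).congr_deriv ?_
      have hw2 : √(1 + sin a ^ 2) ^ 2 = 1 + sin a ^ 2 := sq_sqrt (by positivity)
      have hw0 : 0 < √(1 + sin a ^ 2) := by positivity
      set w := √(1 + sin a ^ 2)
      field_simp
      have := sin_sq_add_cos_sq a
      linear_combination (-sin a) * hw2 - sin a * this)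
    (Continuous.intervalIntegrable (by
      refine (Continuous.div (by fun_prop) (by fun_prop) fun a => ?_)
      positivity) _ _)
  rw [h]; simp [arctan_neg]; ring

open Real in
lemma int_ccsw : ∫ a in (0:ℝ)..π, cos a ^ 2 * (sin a * √(1 + sin a ^ 2)) = π/4 := by
  have h := intervalIntegral.integral_eq_sub_of_hasDerivAt (a := 0) (b := π)
    (f := fun a => cos a * (sin a ^ 2 * √(1 + sin a ^ 2)) / 4 - arctan (cos a / √(1 + sin a ^ 2)) / 2)
    (f' := fun a => cos a ^ 2 * (sin a * √(1 + sin a ^ 2))) (fun a _ => by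
      refine ((((hasDerivAt_cos a).mul (((hasDerivAt_sin a).pow 2).mul (w_deriv a))).div_const 4).sub ((theta_deriv a).div_const 2)).congr_deriv ?_
      simp only [Pi.pow_apply, Pi.mul_apply]
      have hw2 : √(1 + sin a ^ 2) ^ 2 = 1 + sin a ^ 2 := sq_sqrt (by positivity)
      have hw0 : 0 < √(1 + sin a ^ 2) := by positivity
      set w := √(1 + sin a ^ 2)
      field_simp
      norm_num
      have hc : cos a ^ 2 = 1 - sin a ^ 2 := by linarith [sin_sq_add_cos_sq a]
      rw [hc]
      ring_nf
      rw [hw2]; ring)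
    (Continuous.intervalIntegrable (by fun_prop) _ _)
  rw [h]; simp [arctan_neg]; ring

open Real in
lemma int_arctan_div : ∫ t in Ioo (0:ℝ) 1, arctan t / t = catalanConst := by
  have hcv : ∀ f : ℝ → ℝ, ∫ t in Ioo (0:ℝ) 1, f t = ∫ x in (0:ℝ)..1, f x := fun f => by
    rw [intervalIntegral.integral_of_le zero_le_one, integral_Ioc_eq_integral_Ioo]
  have hi : ∀ n : ℕ, ∫ t in Ioo (0:ℝ) 1, t^(2*n) = 1/(2*(n:ℝ)+1) := by
    intro n; rw [hcv, integral_pow]; push_cast; simp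
  have H := hasSum_integral_of_summable_integral_norm (μ := volume.restrict (Ioo (0:ℝ) 1))
    (F := fun (n : ℕ) t => (-1)^n / (2*(n:ℝ)+1) * t^(2*n)) ?_ ?_
  · have e1 : ∀ n : ℕ, ∫ t in Ioo (0:ℝ) 1, (-1)^n / (2*(n:ℝ)+1) * t^(2*n) = (-1)^n / (2*(n:ℝ)+1)^2 := by
      intro n; rw [integral_const_mul, hi, div_mul_div_comm, mul_one, sq]
    simp only [e1] at H
    rw [catalanConst, H.tsum_eq]
    refine setIntegral_congr_fun measurableSet_Ioo fun t ht => ?_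
    have h := (Real.hasSum_arctan (x := t) (by rw [norm_eq_abs, abs_of_pos ht.1]; exact ht.2)).div_const t
    rw [← h.tsum_eq]
    congr 1; ext n
    have := ht.1
    push_cast
    field_simp
    ring
  · intro n
    exact (Continuous.integrableOn_Icc (by fun_prop)).mono_set Ioo_subset_Icc_self
  · have e1 : ∀ n : ℕ, ∫ t in Ioo (0:ℝ) 1, ‖(-1)^n / (2*(n:ℝ)+1) * t^(2*n)‖ = 1 / (2*(n:ℝ)+1)^2 := by
      intro n
      have : ∀ t : ℝ, ‖(-1)^n / (2*(n:ℝ)+1) * t^(2*n)‖ = 1 / (2*(n:ℝ)+1) * t^(2*n) := by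
        intro t
        rw [norm_mul, norm_div, norm_pow, norm_neg, norm_one, one_pow, norm_of_nonneg (by positivity), norm_of_nonneg ((even_two_mul n).pow_nonneg t)]
      simp only [this]
      rw [integral_const_mul, hi, div_mul_div_comm, mul_one, sq]
    simp only [e1]
    have hs : Summable (fun n : ℕ => 1 / ((n:ℝ)+1)^2) := by
      have := (summable_nat_add_iff 1).2 (Real.summable_one_div_nat_pow.2 (one_lt_two))
      simpa using this
    refine Summable.of_nonneg_of_le (fun n => by positivity) (fun n => ?_) hs
    gcongr
    linarith [(Nat.cast_nonneg n : (0:ℝ) ≤ n)]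

open Real in
lemma arsinh_eq (S : ℝ) : arsinh S = ∫ t in (0:ℝ)..1, S / √(1 + t^2 * S^2) := by
  have h := intervalIntegral.integral_eq_sub_of_hasDerivAt (a := 0) (b := 1)
    (f := fun t => arsinh (t * S)) (f' := fun t => S / √(1 + t^2 * S^2)) (fun t _ => by
      refine (((hasDerivAt_id t).mul_const S).arsinh).congr_deriv ?_
      simp [mul_pow]; ring)
    (Continuous.intervalIntegrable (by
      refine (Continuous.div (by fun_prop) (by fun_prop) fun a => ?_)
      positivity) _ _)
  rw [h]; simp

open Real in
lemma int_arsinh : ∫ a in (0:ℝ)..π, arsinh (sin a) = 2 * catalanConst := by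
  simp only [arsinh_eq]
  rw [intervalIntegral.integral_of_le pi_pos.le, integral_Ioc_eq_integral_Ioo]
  simp only [intervalIntegral.integral_of_le zero_le_one, integral_Ioc_eq_integral_Ioo]
  rw [integral_integral_swap]
  · rw [← int_arctan_div, ← integral_const_mul]
    refine setIntegral_congr_fun measurableSet_Ioo fun t ht => ?_
    rw [← int_sin_div t ht.1, intervalIntegral.integral_of_le pi_pos.le, integral_Ioc_eq_integral_Ioo]
  · rw [Measure.prod_restrict]
    refine IntegrableOn.mono_set (t := Icc 0 π ×ˢ Icc 0 1) ?_ (prod_mono Ioo_subset_Icc_self Ioo_subset_Icc_self)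
    refine ContinuousOn.integrableOn_compact (isCompact_Icc.prod isCompact_Icc) (Continuous.continuousOn ?_)
    refine (Continuous.div (by fun_prop) (by fun_prop) fun a => ?_)
    positivity

open Real in
lemma int_X : ∫ a in (0:ℝ)..π, cos a ^ 2 * arsinh (sin a) = 1/2 + catalanConst - π/4 := by
  have c1 : IntervalIntegrable (fun a => (2 * cos a ^ 2 - 1) * arsinh (sin a)) volume 0 π :=
    Continuous.intervalIntegrable (Continuous.mul (by fun_prop) (continuous_arsinh.comp continuous_sin)) _ _
  have c2 : IntervalIntegrable (fun a => sin a * cos a ^ 2 / √(1 + sin a ^ 2)) volume 0 π :=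
    Continuous.intervalIntegrable (by
      refine (Continuous.div (by fun_prop) (by fun_prop) fun a => ?_)
      positivity) _ _
  have c3 : IntervalIntegrable (fun a => arsinh (sin a)) volume 0 π :=
    Continuous.intervalIntegrable (continuous_arsinh.comp continuous_sin) _ _
  have h := intervalIntegral.integral_eq_sub_of_hasDerivAt (a := 0) (b := π)
    (f := fun a => sin a * cos a * arsinh (sin a))
    (f' := fun a => (2 * cos a ^ 2 - 1) * arsinh (sin a) + sin a * cos a ^ 2 / √(1 + sin a ^ 2)) (fun a _ => by
      refine (((hasDerivAt_sin a).mul (hasDerivAt_cos a)).mul ((hasDerivAt_sin a).arsinh)).congr_deriv ?_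
      simp only [Pi.mul_apply, smul_eq_mul]
      linear_combination (-arsinh (sin a)) * sin_sq_add_cos_sq a) (c1.add c2)
  rw [intervalIntegral.integral_add c1 c2, int_scc] at h
  simp at h
  have e : ∀ a, cos a ^ 2 * arsinh (sin a) = 1/2 * (arsinh (sin a) + (2 * cos a ^ 2 - 1) * arsinh (sin a)) := fun a => by ring
  simp only [e]
  rw [intervalIntegral.integral_const_mul, intervalIntegral.integral_add c3 c1, int_arsinh]
  linarith

open Real in
lemma int_ccss : ∫ a in (0:ℝ)..π, cos a ^ 2 * sin a ^ 2 = π/8 := by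
  have h := integral_sin_sq_mul_cos_sq (a := 0) (b := π)
  have h4 : sin (4*π) = 0 := by have := sin_nat_mul_pi 4; simpa using this
  simp only [mul_comm (cos _ ^ 2)]
  rw [h, h4]; simp

open Real in
lemma step3 : ∫ a in Ioo (0:ℝ) π, ∫ b in Ioo (0:ℝ) π, cos a ^ 2 * cos b ^ 2 *
      (eulerMascheroniConstant + log (sin a ^ 2) + log (sin b ^ 2) - log (sin a ^ 2 + sin b ^ 2))
      = (π/2) * (eulerMascheroniConstant * π / 2 - π * log 2 - π/4 - 1 - 2 * catalanConst) := by
  have hcv : ∀ f : ℝ → ℝ, ∫ x in Ioo (0:ℝ) π, f x = ∫ x in (0:ℝ)..π, f x := fun f => by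
    rw [intervalIntegral.integral_of_le pi_pos.le, integral_Ioc_eq_integral_Ioo]
  have hcos : ∫ x in (0:ℝ)..π, cos x ^ 2 = π/2 := by rw [integral_cos_sq]; simp
  have hin : ∀ a ∈ Ioo (0:ℝ) π, (∫ b in Ioo (0:ℝ) π, cos a ^ 2 * cos b ^ 2 *
      (eulerMascheroniConstant + log (sin a ^ 2) + log (sin b ^ 2) - log (sin a ^ 2 + sin b ^ 2)))
      = (π/2) * (cos a ^ 2 * log (sin a ^ 2) + (eulerMascheroniConstant * cos a ^ 2 + (-2) * (cos a ^ 2 * arsinh (sin a))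
        + 2 * (cos a ^ 2 * sin a ^ 2) + (-2) * (cos a ^ 2 * (sin a * √(1 + sin a ^ 2))))) := by
    intro a ha
    have hS := sin_pos_of_mem_Ioo ha
    rw [hcv]
    have i1 : IntervalIntegrable (fun b => (eulerMascheroniConstant + log (sin a ^ 2)) * cos b ^ 2) volume 0 π :=
      Continuous.intervalIntegrable (by fun_prop) _ _
    have i2 := cosLogSin_integrable
    have i3 : IntervalIntegrable (fun b => cos b ^ 2 * log (sin a ^ 2 + sin b ^ 2)) volume 0 π := by
      refine Continuous.intervalIntegrable (Continuous.mul (by fun_prop) (Continuous.log (by fun_prop) fun b => ?_)) _ _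
      positivity
    have i12 : IntervalIntegrable (fun b => (eulerMascheroniConstant + log (sin a ^ 2)) * cos b ^ 2 + cos b ^ 2 * log (sin b ^ 2)) volume 0 π := i1.add i2
    have e : ∀ b, cos a ^ 2 * cos b ^ 2 *
      (eulerMascheroniConstant + log (sin a ^ 2) + log (sin b ^ 2) - log (sin a ^ 2 + sin b ^ 2)) =
      cos a ^ 2 * ((eulerMascheroniConstant + log (sin a ^ 2)) * cos b ^ 2 + cos b ^ 2 * log (sin b ^ 2) - cos b ^ 2 * log (sin a ^ 2 + sin b ^ 2)) := fun b => by ring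
    simp only [e]
    rw [intervalIntegral.integral_const_mul, intervalIntegral.integral_sub i12 i3, intervalIntegral.integral_add i1 i2,
      intervalIntegral.integral_const_mul, hcos, cosLogSin, inner_log _ hS]
    ring
  rw [setIntegral_congr_fun measurableSet_Ioo hin, hcv, intervalIntegral.integral_const_mul]
  have c1 : IntervalIntegrable (fun a => eulerMascheroniConstant * cos a ^ 2) volume 0 π :=
    Continuous.intervalIntegrable (by fun_prop) _ _
  have c2 : IntervalIntegrable (fun a => (-2) * (cos a ^ 2 * arsinh (sin a))) volume 0 π :=
    Continuous.intervalIntegrable (continuous_const.mul (Continuous.mul (by fun_prop) (continuous_arsinh.comp continuous_sin))) _ _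
  have c3 : IntervalIntegrable (fun a => 2 * (cos a ^ 2 * sin a ^ 2)) volume 0 π :=
    Continuous.intervalIntegrable (by fun_prop) _ _
  have c4 : IntervalIntegrable (fun a => (-2) * (cos a ^ 2 * (sin a * √(1 + sin a ^ 2)))) volume 0 π :=
    Continuous.intervalIntegrable (by fun_prop) _ _
  rw [intervalIntegral.integral_add cosLogSin_integrable (((c1.add c2).add c3).add c4),
    intervalIntegral.integral_add ((c1.add c2).add c3) c4, intervalIntegral.integral_add (c1.add c2) c3,
    intervalIntegral.integral_add c1 c2, intervalIntegral.integral_const_mul, intervalIntegral.integral_const_mul,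
    intervalIntegral.integral_const_mul, intervalIntegral.integral_const_mul, cosLogSin, hcos, int_X, int_ccss, int_ccsw]
  ring

open Real in
lemma final :
    ∫ x in Ioi (0:ℝ), ∫ y in Ioi (0:ℝ),
        besselJ 1 x ^ 2 * besselJ 1 y ^ 2 / (x*y) * Real.log (x^2 + y^2)
      = (4 + 8*catalanConst + Real.pi - 4*Real.eulerMascheroniConstant*Real.pi
          + 4*Real.pi*Real.log 2) / (8*Real.pi) := by
  have h := step2
  rw [step3] at h
  rw [step1]
  have hp := pi_pos
  have hK : ∫ s in Ioi (0:ℝ), K2 s = (eulerMascheroniConstant * π / 2 - π * log 2 - π/4 - 1 - 2 * catalanConst) / (π/2) := by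
    rw [eq_div_iff (by positivity)]
    have : (π/2) * ((∫ s in Ioi (0:ℝ), K2 s) * (π/2)) = (π/2) * (eulerMascheroniConstant * π / 2 - π * log 2 - π/4 - 1 - 2 * catalanConst) := by
      rw [h]; ring
    exact mul_left_cancel₀ (by positivity) this
  rw [hK]
  field_simp
  ring

end BLI

theorem bessel_log_double_integral :
    ∫ x in Set.Ioi (0:ℝ), ∫ y in Set.Ioi (0:ℝ),
        besselJ 1 x ^ 2 * besselJ 1 y ^ 2 / (x*y) * Real.log (x^2 + y^2)
      = (4 + 8*catalanConst + Real.pi - 4*Real.eulerMascheroniConstant*Real.pi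
          + 4*Real.pi*Real.log 2) / (8*Real.pi) := by
  exact BLI.final
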